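/- Let p be a prime, N ≥ 1, and let ρ be an injective group homomorphism from ℤ/pℤ (written additively) to the group of ℝ-linear automorphisms of ℝ^N = (Fin N → ℝ) (a faithful real representation of ℤ/pℤ). Call a polynomial f ∈ MvPolynomial (Fin N) ℝ invariant if eval(ρ(g)(v), f) = eval(v, f) for all g ∈ ℤ/pℤ and all v ∈ ℝ^N, and say the invariants of degree ≤ d are separating if for all v, w ∈ ℝ^N with eval(v, f) = eval(w, f) for every invariant f of total degree ≤ d, there exists g ∈ ℤ/pℤ with ρ(g)(w) = v. Then the invariants of degree ≤ p are separating, while for every d < p the invariants of degree ≤ d are not separating; that is, β_sep(ℤ/pℤ, V) = p for every faithful finite-dimensional real representation V of ℤ/pℤ. -/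

import Mathlib

open MvPolynomial in
/-- Every linear functional on `ι → K` is evaluation of a polynomial of degree at most one. -/
theorem exists_totalDegree_le_one_eval_eq_dual {ι K : Type*} [Fintype ι] [Field K]
    (φ : Module.Dual K (ι → K)) :
    ∃ f : MvPolynomial ι K, f.totalDegree ≤ 1 ∧ ∀ v, eval v f = φ v := by
  classical
  refine ⟨∑ i, C (φ (Pi.single i 1)) * X i, ?_, fun v ↦ ?_⟩
  · refine (totalDegree_finsetSum _ _).trans (Finset.sup_le fun i _ ↦ ?_)
    refine (totalDegree_mul _ _).trans ?_
    simp
  · conv_rhs => rw [pi_eq_sum_univ' v, map_sum]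
    simp [mul_comm]

open MvPolynomial in
/-- The invariants of degree at most the group order separate the orbits of a finite group. -/
theorem exists_mem_orbit_of_forall_invariant_eval_eq {ι K G : Type*} [Fintype ι] [Field K]
    [Infinite K] [Group G] [Fintype G] (ρ : G →* ((ι → K) ≃ₗ[K] (ι → K))) (v w : ι → K)
    (h : ∀ f : MvPolynomial ι K, (∀ g v', eval (ρ g v') f = eval v' f) →
      f.totalDegree ≤ Fintype.card G → eval v f = eval w f) :
    ∃ g, ρ g w = v := by
  by_contra! hne
  obtain ⟨φ, hφ⟩ := Module.exists_dual_forall_apply_ne_zero (K := K) (fun g ↦ ρ g w - v)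
    fun g ↦ sub_ne_zero.2 (hne g)
  choose L hLdeg hL using fun g ↦
    exists_totalDegree_le_one_eval_eq_dual (φ ∘ₗ (ρ g).toLinearMap)
  let f : MvPolynomial ι K := ∏ g, (L g - C (φ v))
  have hf (x : ι → K) : eval x f = ∏ g, φ (ρ g x - v) := by simp [f, hL, map_prod]
  have hinv (g : G) (x : ι → K) : eval (ρ g x) f = eval x f := by
    rw [hf, hf, ← Equiv.prod_comp (Equiv.mulRight g) fun k ↦ φ (ρ k x - v)]
    simp
  have hdeg : f.totalDegree ≤ Fintype.card G := by
    refine (totalDegree_finsetProd _ _).trans ?_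
    refine (Finset.sum_le_card_nsmul _ _ 1 fun g _ ↦ ?_).trans (by simp)
    exact (totalDegree_sub_C_le _ _).trans (hLdeg g)
  have hv : eval v f = 0 := by
    rw [hf]
    exact Finset.prod_eq_zero (Finset.mem_univ 1) (by simp)
  have hw : eval w f ≠ 0 := by
    rw [hf]
    exact Finset.prod_ne_zero_iff.2 fun g _ ↦ hφ g
  exact hw (h f hinv hdeg ▸ hv)

open Polynomial in
/-- Restricting a polynomial of degree at most `n` to the curve `z ↦ a z + b z⁻¹` and multiplying
by `z ^ n` gives a polynomial of degree at most `2 n`. -/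
theorem exists_natDegree_le_eval_eq_pow_mul_eval {ι K : Type*} [Field K]
    (f : MvPolynomial ι K) {n : ℕ} (hf : f.totalDegree ≤ n) (a b : ι → K) :
    ∃ P : K[X], P.natDegree ≤ 2 * n ∧
      ∀ z ≠ 0, P.eval z = z ^ n * MvPolynomial.eval (fun i ↦ a i * z + b i * z⁻¹) f := by
  have hdeg {m : ι →₀ ℕ} (hm : m ∈ f.support) : ∑ i ∈ m.support, m i ≤ n :=
    (MvPolynomial.le_totalDegree hm).trans hf
  refine ⟨∑ m ∈ f.support, C (f.coeff m) *
    (X ^ (n - ∑ i ∈ m.support, m i) * ∏ i ∈ m.support, (C (a i) * X ^ 2 + C (b i)) ^ m i),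
    natDegree_sum_le_of_forall_le _ _ fun m hm ↦ ?_, fun z hz ↦ ?_⟩
  · have hprod : (∏ i ∈ m.support, (C (a i) * X ^ 2 + C (b i)) ^ m i).natDegree ≤
        ∑ i ∈ m.support, m i * 2 := by
      refine (natDegree_prod_le _ _).trans (Finset.sum_le_sum fun i _ ↦ ?_)
      exact natDegree_pow_le_of_le _ (by compute_degree)
    rw [← Finset.sum_mul] at hprod
    refine (natDegree_C_mul_le _ _).trans (natDegree_mul_le.trans ?_)
    have := hdeg hm
    rw [natDegree_X_pow]
    omega
  · rw [MvPolynomial.eval_eq, eval_finsetSum, Finset.mul_sum]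
    refine Finset.sum_congr rfl fun m hm ↦ ?_
    have hfactor (i : ι) : a i * z ^ 2 + b i = z * (a i * z + b i * z⁻¹) := by
      field_simp
    simp only [eval_mul, eval_C, eval_pow, eval_X, eval_prod, eval_add, hfactor, mul_pow,
      Finset.prod_mul_distrib, Finset.prod_pow_eq_pow_sum]
    rw [← mul_assoc (z ^ _), ← pow_add, Nat.sub_add_cancel (hdeg hm)]
    ring

open Polynomial in
/-- A polynomial of degree at most `2 n` that scales by `ζ ^ n` under `z ↦ ζ z`, where `ζ` is a
primitive `p`-th root of unity and `n < p`, is a multiple of `X ^ n`. -/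
theorem IsPrimitiveRoot.eq_C_mul_X_pow_of_comp_eq {K : Type*} [Field K] {ζ : K} {p n : ℕ}
    (hζ : IsPrimitiveRoot ζ p) (hn : n < p) {P : K[X]} (hP : P.natDegree ≤ 2 * n)
    (h : P.comp (C ζ * X) = C (ζ ^ n) * P) : P = C (P.coeff n) * X ^ n := by
  ext k
  rw [coeff_C_mul, coeff_X_pow]
  split_ifs with hk
  · simp [hk]
  rw [mul_zero]
  by_contra hne
  have hk2 : k ≤ 2 * n := (le_natDegree_of_ne_zero hne).trans hP
  have hcoeff : P.coeff k * ζ ^ k = ζ ^ n * P.coeff k := by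
    simpa only [comp_C_mul_X_coeff, coeff_C_mul] using congrArg (coeff · k) h
  have hpow : ζ ^ k = ζ ^ n := mul_left_cancel₀ hne (by rw [hcoeff, mul_comm])
  have hmod : k ≡ n [MOD p] := by
    rw [hζ.eq_orderOf]
    exact (isOfFinOrder_iff_pow_eq_one.2 ⟨p, by omega, hζ.pow_eq_one⟩).pow_eq_pow_iff_modEq.1 hpow
  rcases lt_or_gt_of_ne hk with hlt | hlt
  · exact hk (hmod.eq_of_lt_of_lt (hlt.trans hn) hn)
  · have hdvd : p ∣ k - n := (Nat.modEq_iff_dvd' hlt.le).1 hmod.symm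
    have := Nat.le_of_dvd (by omega) hdvd
    omega

/-- An invariant of degree less than `p` is constant on the ellipse spanned by an eigenvector for a
primitive `p`-th root of unity. -/
theorem eval_re_mul_eq_of_invariant {ι : Type*} {ζ : ℂ} {p n : ℕ} (hζ : IsPrimitiveRoot ζ p)
    (hn : n < p) {f : MvPolynomial ι ℝ} (hf : f.totalDegree ≤ n) (u : ι → ℂ)
    (hinv : ∀ z : ℂ, MvPolynomial.eval (fun i ↦ (ζ * z * u i).re) f =
      MvPolynomial.eval (fun i ↦ (z * u i).re) f)
    {z w : ℂ} (hz : ‖z‖ = 1) (hw : ‖w‖ = 1) :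
    MvPolynomial.eval (fun i ↦ (z * u i).re) f = MvPolynomial.eval (fun i ↦ (w * u i).re) f := by
  obtain ⟨P, hPdeg, hP⟩ := exists_natDegree_le_eval_eq_pow_mul_eval
    (MvPolynomial.map Complex.ofRealHom f)
    ((Finset.sup_mono (MvPolynomial.support_map_subset _ _)).trans hf)
    (fun i ↦ u i / 2) (fun i ↦ (starRingEnd ℂ) (u i) / 2)
  have hPcirc {z : ℂ} (hz : ‖z‖ = 1) :
      P.eval z = z ^ n * (MvPolynomial.eval (fun i ↦ (z * u i).re) f : ℝ) := by
    rw [hP z (by rintro rfl; simp at hz), MvPolynomial.eval_map, ← Complex.ofRealHom_eq_coe,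
      MvPolynomial.eval, MvPolynomial.coe_eval₂Hom, MvPolynomial.eval₂_comp_left,
      RingHomCompTriple.comp_eq]
    congr 2
    ext1 i
    simp only [Function.comp, Complex.ofRealHom_eq_coe, Complex.re_eq_add_conj, map_mul,
      ← Complex.inv_eq_conj hz]
    ring
  have hζnorm : ‖ζ‖ = 1 := hζ.norm'_eq_one (by omega)
  have hcomp : P.comp (Polynomial.C ζ * Polynomial.X) = Polynomial.C (ζ ^ n) * P := by
    refine Polynomial.eq_of_infinite_eval_eq _ _ (Set.Infinite.mono (s := Metric.sphere 0 1) ?_ ?_)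
    · intro z hz
      have hz' : ‖z‖ = 1 := by simpa using hz
      have hζz : ‖ζ * z‖ = 1 := by rw [norm_mul, hζnorm, hz', one_mul]
      simp only [Set.mem_ofPred_eq, Polynomial.eval_comp, Polynomial.eval_mul, Polynomial.eval_C,
        Polynomial.eval_X, hPcirc hz', hPcirc hζz, hinv]
      ring
    · have : 1 < Module.rank ℝ ℂ := by simp [Complex.rank_real_complex]
      refine (isPreconnected_sphere this 0 1).infinite_of_nontrivial
        ⟨1, by simp, -1, by simp, by norm_num⟩
  have hmono := hζ.eq_C_mul_X_pow_of_comp_eq hn hPdeg hcomp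
  have hconst {z : ℂ} (hz : ‖z‖ = 1) :
      ((MvPolynomial.eval (fun i ↦ (z * u i).re) f : ℝ) : ℂ) = P.coeff n := by
    have hz0 : z ^ n ≠ 0 := pow_ne_zero _ (by rintro rfl; simp at hz)
    refine mul_left_cancel₀ hz0 ?_
    rw [← hPcirc hz]
    conv_lhs => rw [hmono]
    rw [Polynomial.eval_C_mul, Polynomial.eval_X_pow, mul_comm]
  exact_mod_cast (hconst hz).trans (hconst hw).symm

open ZMod in
/-- A nontrivial real representation of `ℤ/pℤ` has a complex eigenvector whose eigenvalue is a
primitive `p`-th root of unity. -/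
theorem exists_isPrimitiveRoot_eigenvector {ι : Type*} {p : ℕ} [Fact p.Prime]
    (ρ : Multiplicative (ZMod p) →* ((ι → ℝ) ≃ₗ[ℝ] (ι → ℝ))) (hρ : ρ ≠ 1) :
    ∃ (ζ : ℂ) (u : ι → ℂ), IsPrimitiveRoot ζ p ∧ u ≠ 0 ∧ ∀ z : ℂ,
      ρ (Multiplicative.ofAdd 1) (fun i ↦ (z * u i).re) = fun i ↦ (ζ * z * u i).re := by
  obtain ⟨g, x, i, hgx⟩ : ∃ g x i, ρ (Multiplicative.ofAdd g) x i ≠ x i := by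
    by_contra! h
    exact hρ (MonoidHom.ext fun g ↦ LinearEquiv.ext fun x ↦ funext fun i ↦ h g.toAdd x i)
  let Φ (i : ι) (k : ZMod p) : ℂ := (ρ (Multiplicative.ofAdd k) x i : ℝ)
  obtain ⟨j, hj, hΦj⟩ : ∃ j ≠ 0, 𝓕 (Φ i) j ≠ 0 := by
    by_contra! h
    have hconst (k : ZMod p) : Φ i k = (p : ℂ)⁻¹ * 𝓕 (Φ i) 0 := by
      conv_lhs => rw [← LinearEquiv.symm_apply_apply dft (Φ i)]
      rw [invDFT_apply, Finset.sum_eq_single 0 (fun j _ hj ↦ by rw [h j hj, smul_zero]) (by simp)]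
      simp
    have := (hconst g).trans (hconst 0).symm
    exact hgx (by simpa [Φ] using this)
  refine ⟨stdAddChar j, fun i ↦ 𝓕 (Φ i) j, ?_, fun h ↦ hΦj (congrFun h i), fun z ↦ ?_⟩
  · refine IsPrimitiveRoot.iff_orderOf.2 (orderOf_eq_prime ?_ fun h ↦ hj ?_)
    · rw [← AddChar.map_nsmul_eq_pow]
      simp
    · exact injective_stdAddChar (h.trans (AddChar.map_zero_eq_one _).symm)
  · have hexp (z : ℂ) : (fun i ↦ (z * 𝓕 (Φ i) j).re) =
        ∑ k, (z * stdAddChar (-(k * j))).re • ρ (Multiplicative.ofAdd k) x := by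
      ext i
      simp [dft_apply, Φ, Finset.mul_sum, ← mul_assoc, Complex.re_sum]
    rw [hexp, hexp, map_sum,
      ← Equiv.sum_comp (Equiv.addLeft 1) fun k ↦ (_ : ℝ) • ρ (Multiplicative.ofAdd k) x]
    refine Finset.sum_congr rfl fun k _ ↦ ?_
    have hchar : stdAddChar j * z * stdAddChar (-((1 + k) * j)) =
        z * stdAddChar (-(k * j)) := by
      rw [mul_comm _ z, mul_assoc, ← AddChar.map_add_eq_mul]
      congr 2
      ring
    rw [Equiv.coe_addLeft, hchar, ofAdd_add, map_mul, _root_.map_smul, LinearEquiv.mul_apply]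

/-- Let `p` be prime, `N ≥ 1`, and `ρ` a faithful representation of `ℤ/pℤ`
by `ℝ`-linear automorphisms of `ℝ^N`. Then the invariant polynomials of degree `≤ p` separate
the orbits, while for every `d < p` the invariants of degree `≤ d` do not; that is,
`β_sep(ℤ/pℤ, V) = p`. -/
theorem stmt_18 (p : ℕ) (hp : p.Prime) (N : ℕ) (hN : 1 ≤ N)
    (ρ : Multiplicative (ZMod p) →* ((Fin N → ℝ) ≃ₗ[ℝ] (Fin N → ℝ)))
    (hρ : Function.Injective ρ) :
    (∀ v w : Fin N → ℝ,
        (∀ f : MvPolynomial (Fin N) ℝ,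
            (∀ (g : Multiplicative (ZMod p)) (v' : Fin N → ℝ),
              MvPolynomial.eval (ρ g v') f = MvPolynomial.eval v' f) →
            f.totalDegree ≤ p →
            MvPolynomial.eval v f = MvPolynomial.eval w f) →
        ∃ g : Multiplicative (ZMod p), ρ g w = v) ∧
      ∀ d : ℕ, d < p →
        ¬ (∀ v w : Fin N → ℝ,
            (∀ f : MvPolynomial (Fin N) ℝ,
                (∀ (g : Multiplicative (ZMod p)) (v' : Fin N → ℝ),
                  MvPolynomial.eval (ρ g v') f = MvPolynomial.eval v' f) →
                f.totalDegree ≤ d →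
                MvPolynomial.eval v f = MvPolynomial.eval w f) →
            ∃ g : Multiplicative (ZMod p), ρ g w = v) := by
  have : Fact p.Prime := ⟨hp⟩
  refine ⟨fun v w h ↦ exists_mem_orbit_of_forall_invariant_eval_eq ρ v w fun f hf hdeg ↦
    h f hf (by simpa using hdeg), fun d hd hsep ↦ ?_⟩
  have hρ1 : ρ ≠ 1 := by
    rintro rfl
    have := hρ (a₁ := Multiplicative.ofAdd 1) (a₂ := 1) rfl
    simp at this
  obtain ⟨ζ, u, hζ, hu, hρu⟩ := exists_isPrimitiveRoot_eigenvector ρ hρ1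
  obtain ⟨i, hi⟩ := Function.ne_iff.1 hu
  have horbit {z : ℂ} (hz : ‖z‖ = 1) :
      ∃ g, ρ g (fun i ↦ (1 * u i).re) = fun i ↦ (z * u i).re :=
    hsep _ _ fun f hf hdeg ↦ eval_re_mul_eq_of_invariant hζ hd hdeg u
      (fun z ↦ by rw [← hρu, hf]) hz norm_one
  have : Infinite (Set.Icc (-1 : ℝ) 1) := (Set.Icc_infinite (by norm_num)).to_subtype
  refine (Set.infinite_range_of_injective (α := Set.Icc (-1 : ℝ) 1) (f := fun t ↦ ‖u i‖ * t)
    fun s t hst ↦ Subtype.ext (mul_left_cancel₀ (norm_ne_zero_iff.2 hi) hst)) ?_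
  refine (Set.finite_range fun g ↦ ρ g (fun i ↦ (1 * u i).re) i).subset ?_
  rintro _ ⟨⟨t, ht⟩, rfl⟩
  let z : ℂ := Complex.exp ((Real.arccos t - (u i).arg : ℝ) * Complex.I)
  obtain ⟨g, hg⟩ := horbit (z := z) (Complex.norm_exp_ofReal_mul_I _)
  refine ⟨g, ?_⟩
  have hzu : z * u i = ‖u i‖ * Complex.exp (Real.arccos t * Complex.I) := by
    conv_lhs => rw [← Complex.norm_mul_exp_arg_mul_I (u i)]
    rw [mul_left_comm, ← Complex.exp_add]
    congr 2
    push_cast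
    ring
  simp only [hg, hzu, Complex.re_ofReal_mul, Complex.exp_ofReal_mul_I_re, Real.cos_arccos ht.1 ht.2]
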